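/- Let D₀ and D₁ be self-adjoint operators on Hilbert spaces H₀ and H₁, and suppose a : H₀ → H₁ is bounded with a(dom D₀) ⊆ dom D₁ such that (D₁ a - a D₀)⟨D₀⟩^{-α} extends to a bounded operator for some 0 ≤ α < 1. Then for every β < 1 - α, the operator (F_{D₁} a - a F_{D₀})⟨D₀⟩^β is bounded, where F_D = D(1+D²)^{-1/2} and ⟨D⟩ = (1+D²)^{1/2}. -/

import Mathlib

open Filter Topology

lemma aux_scalar (n : ℕ) (γ q : ℝ) (hγ0 : 0 ≤ γ) (hγ1 : γ ≤ 1) (hq0 : 0 ≤ q) (hq1 : q ≤ 1) :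
    ((1 - q) * (1 / (1 + q))) ^ n * (q ^ γ * q ^ γ) ≤ (((n : ℝ) + 1) ^ (-γ)) ^ 2 := by
  have hn : (0 : ℝ) ≤ n := Nat.cast_nonneg n
  have h1 : (1 - q) * (1 / (1 + q)) ≤ ((1 + q) ^ 2)⁻¹ := by
    rw [← one_div, mul_one_div, div_le_div_iff₀ (by positivity) (by positivity)]
    nlinarith [mul_nonneg hq0 hq0, mul_nonneg (mul_nonneg hq0 hq0) hq0]
  have h0 : 0 ≤ (1 - q) * (1 / (1 + q)) := mul_nonneg (by linarith) (by positivity)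
  have hB : 1 + n * q ≤ (1 + q) ^ n := one_add_mul_le_pow (by linarith) n
  have hBp : 0 < 1 + n * q := by positivity
  have h2 : ((1 - q) * (1 / (1 + q))) ^ n ≤ ((1 + n * q) ^ 2)⁻¹ := by
    calc _ ≤ (((1 + q) ^ 2)⁻¹) ^ n := pow_le_pow_left₀ h0 h1 n
      _ = (((1 + q) ^ n) ^ 2)⁻¹ := by rw [inv_pow, ← pow_mul, ← pow_mul, mul_comm]
      _ ≤ _ := by gcongr
  have h3 : ((n : ℝ) + 1) ^ γ * q ^ γ ≤ 1 + n * q := by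
    rw [← Real.mul_rpow (by positivity) hq0]
    calc _ ≤ (1 + n * q) ^ γ := by
          apply Real.rpow_le_rpow (by positivity) _ hγ0
          nlinarith
      _ ≤ (1 + n * q) ^ (1 : ℝ) := by
          apply Real.rpow_le_rpow_of_exponent_le _ hγ1
          have : 0 ≤ n * q := by positivity
          linarith
      _ = _ := Real.rpow_one _
  have hp : 0 < ((n : ℝ) + 1) ^ γ := by positivity
  have h4 : q ^ γ ≤ (((n : ℝ) + 1) ^ γ)⁻¹ * (1 + n * q) := by
    rw [inv_mul_eq_div, le_div_iff₀ hp]; linarith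
  have hqg : 0 ≤ q ^ γ := by positivity
  rw [Real.rpow_neg (by positivity)]
  calc _ ≤ ((1 + n * q) ^ 2)⁻¹ * (((((n : ℝ) + 1) ^ γ)⁻¹ * (1 + n * q)) *
            ((((n : ℝ) + 1) ^ γ)⁻¹ * (1 + n * q))) := by gcongr
    _ = _ := by field_simp

lemma aux_op {H : Type*} [NormedAddCommGroup H] [InnerProductSpace ℂ H] [CompleteSpace H]
    (F Q : H →L[ℂ] H) (hQpos : Q.IsPositive)
    (hF : IsSelfAdjoint F) (hFQ : F * Q = Q * F) (hpyth : F * F + Q * Q = 1) :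
    (∀ x ∈ spectrum ℝ Q, 0 ≤ x ∧ x ≤ 1) ∧
    ∃ t : H →L[ℂ] H, F = t + t * Q ∧ t * F = 1 - Q ∧ F * t = 1 - Q ∧ Commute t Q ∧
      ∀ (n : ℕ) (γ : ℝ), 0 ≤ γ → γ ≤ 1 →
        ‖t ^ n * cfc (fun x : ℝ => x ^ γ) Q‖ ≤ ((n : ℝ) + 1) ^ (-γ) := by
  have hQsa : IsSelfAdjoint Q := hQpos.isSelfAdjoint
  have hQnn : 0 ≤ Q := (ContinuousLinearMap.nonneg_iff_isPositive Q).2 hQpos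
  have hspec : ∀ x ∈ spectrum ℝ Q, 0 ≤ x ∧ x ≤ 1 := by
    intro x hx
    have hx0 : 0 ≤ x := spectrum_nonneg_of_nonneg hQnn hx
    refine ⟨hx0, ?_⟩
    have h : cfc (fun x : ℝ => 1 - x * x) Q = star F * F := by
      rw [cfc_sub _ _ Q, cfc_mul _ _ Q, cfc_const_one ℝ Q, cfc_id' ℝ Q, hF.star_eq, ← hpyth]
      abel
    have h2 : 0 ≤ cfc (fun x : ℝ => 1 - x * x) Q := by rw [h]; exact star_mul_self_nonneg F
    have := (cfc_nonneg_iff (fun x : ℝ => 1 - x * x) Q).1 h2 x hx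
    nlinarith
  refine ⟨hspec, ?_⟩
  have hcP : ContinuousOn (fun x : ℝ => 1 / (1 + x)) (spectrum ℝ Q) := by
    apply ContinuousOn.div continuousOn_const (by fun_prop)
    intro x hx
    have := (hspec x hx).1
    positivity
  set P := cfc (fun x : ℝ => 1 / (1 + x)) Q with hP
  have hPsa : IsSelfAdjoint P := cfc_predicate _ Q
  have hPQ : P * Q = Q * P := ((Commute.refl Q).cfc_real _).eq
  have hPF : P * F = F * P := by
    have : Commute Q F := hFQ.symm
    exact (this.cfc_real _).eq
  have hP1 : P + P * Q = 1 := by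
    have : P * (1 + Q) = 1 := by
      have h1 : cfc (fun x : ℝ => 1 + x) Q = 1 + Q := by
        rw [cfc_add Q (fun _ : ℝ => (1 : ℝ)) (fun x : ℝ => x), cfc_const_one ℝ Q, cfc_id' ℝ Q]
      rw [← h1, hP, ← cfc_mul (fun x : ℝ => 1 / (1 + x)) (fun x : ℝ => 1 + x) Q hcP (by fun_prop),
        ← cfc_const_one ℝ Q]
      apply cfc_congr
      intro x hx
      have := (hspec x hx).1
      have : 1 + x ≠ 0 := by positivity
      simp only
      field_simp
    rw [← this]; noncomm_ring
  have hFF : F * F = 1 - Q * Q := by rw [← hpyth]; abel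
  have hFFP : F * F * P = 1 - Q := by
    rw [hFF]
    have : (1 - Q * Q) * P = (1 - Q) * (P + P * Q) := by
      rw [hPQ]; noncomm_ring
    rw [this, hP1, mul_one]
  have htQ : Commute (F * P) Q := Commute.mul_left hFQ hPQ
  have htt : (F * P) * (F * P) = cfc (fun x : ℝ => (1 - x) * (1 / (1 + x))) Q := by
    have h1 : cfc (fun x : ℝ => 1 - x) Q = 1 - Q := by
      rw [cfc_sub _ _ Q, cfc_const_one ℝ Q, cfc_id' ℝ Q]
    rw [cfc_mul _ _ Q (by fun_prop) hcP, h1, ← hP, ← hFFP]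
    rw [mul_assoc F P, ← mul_assoc P F P, hPF]; noncomm_ring
  have hcb : ContinuousOn (fun x : ℝ => (1 - x) * (1 / (1 + x))) (spectrum ℝ Q) :=
    ContinuousOn.mul (by fun_prop) hcP
  have htsa : IsSelfAdjoint (F * P) := by
    rw [IsSelfAdjoint, star_mul, hF.star_eq, hPsa.star_eq, hPF]
  refine ⟨F * P, ?_, ?_, ?_, htQ, ?_⟩
  · rw [mul_assoc, ← mul_add, hP1, mul_one]
  · rw [mul_assoc, hPF, ← mul_assoc, hFFP]
  · rw [← mul_assoc, hFFP]
  · intro n γ hγ0 hγ1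
    have hcq : ContinuousOn (fun x : ℝ => x ^ γ) (spectrum ℝ Q) :=
      (Real.continuous_rpow_const hγ0).continuousOn
    set G := cfc (fun x : ℝ => x ^ γ) Q with hG
    have hGsa : IsSelfAdjoint G := cfc_predicate _ Q
    have hGt : Commute G (F * P) := htQ.symm.cfc_real _
    have hA : star ((F * P) ^ n * G) * ((F * P) ^ n * G) =
        cfc (fun x : ℝ => ((1 - x) * (1 / (1 + x))) ^ n * (x ^ γ * x ^ γ)) Q := by
      rw [cfc_mul (fun x : ℝ => ((1 - x) * (1 / (1 + x))) ^ n) (fun x : ℝ => x ^ γ * x ^ γ) Q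
          (hcb.pow n) (hcq.mul hcq), cfc_mul _ _ Q hcq hcq, cfc_pow _ n Q hcb,
        ← htt, ← hG, star_mul, star_pow, htsa.star_eq, hGsa.star_eq]
      have h1 : Commute G ((F * P) ^ n) := hGt.pow_right n
      rw [(Commute.refl (F * P)).mul_pow, mul_assoc G, ← mul_assoc ((F * P) ^ n) ((F * P) ^ n) G,
        ← mul_assoc G, (h1.mul_right h1).eq, mul_assoc]
    have hb : ‖star ((F * P) ^ n * G) * ((F * P) ^ n * G)‖ ≤ (((n : ℝ) + 1) ^ (-γ)) ^ 2 := by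
      rw [hA]
      apply norm_cfc_le (by positivity)
      intro x hx
      obtain ⟨h0, h1⟩ := hspec x hx
      rw [Real.norm_of_nonneg]
      · exact aux_scalar n γ x hγ0 hγ1 h0 h1
      · have : 0 ≤ 1 - x := by linarith
        positivity
    rw [CStarRing.norm_star_mul_self, ← sq] at hb
    exact (sq_le_sq₀ (norm_nonneg _) (by positivity)).1 hb

lemma aux_dense {H : Type*} [NormedAddCommGroup H] [InnerProductSpace ℂ H] [CompleteSpace H]
    (Q : H →L[ℂ] H) (hQ : IsSelfAdjoint Q) (hinj : Function.Injective Q) : DenseRange Q := by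
  have h : (LinearMap.range (Q : H →ₗ[ℂ] H)).topologicalClosure = ⊤ := by
    rw [Submodule.topologicalClosure_eq_top_iff]
    have := ContinuousLinearMap.orthogonal_range Q
    have h2 : ContinuousLinearMap.adjoint Q = Q := hQ.adjoint_eq
    rw [h2] at this
    rw [this]
    exact LinearMap.ker_eq_bot.2 hinj
  have := Submodule.dense_iff_topologicalClosure_eq_top.2 h
  intro x
  have hx := this x
  rwa [LinearMap.coe_range] at hx

/-- **Mixed commutators with bounded transforms.**  Let `D₀` and `D₁` be self-adjoint
operators on Hilbert spaces `H₀` and `H₁`, encoded by their bounded transform pairs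
`(F₀, Q₀)` and `(F₁, Q₁)`: `Fᵢ = Dᵢ(1+Dᵢ²)^{-1/2}`, `Qᵢ = ⟨Dᵢ⟩⁻¹ = (1+Dᵢ²)^{-1/2}`
(`Qᵢ` positive injective, `Fᵢ` self-adjoint, `FᵢQᵢ = QᵢFᵢ`, `Fᵢ² + Qᵢ² = 1`,
`dom Dᵢ = ran Qᵢ`, `Dᵢ(Qᵢξ) = Fᵢξ`).  Suppose `a : H₀ → H₁` is bounded with
`a (dom D₀) ⊆ dom D₁` and `(D₁a - aD₀)⟨D₀⟩^{-α}` extends to a bounded operator for some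
`0 ≤ α < 1`; since `(D₁a - aD₀)(Q₀ξ) = F₁η - a(F₀ξ)` where `a(Q₀ξ) = Q₁η`, and
`⟨D₀⟩^α(Q₀ξ) = Q₀^{1-α}ξ`, this is hypothesis `hrel`.  Then for every `0 ≤ β < 1 - α`,
the operator `(F_{D₁} a - a F_{D₀})⟨D₀⟩^β` is bounded, i.e.
`‖F₁(aζ) - a(F₀ζ)‖ ≤ C ‖Q₀^β ζ‖` for all `ζ`.  (The cases `β < 0` are trivial and
omitted.) -/
theorem stmt17 {H₀ H₁ : Type*}
    [NormedAddCommGroup H₀] [InnerProductSpace ℂ H₀] [CompleteSpace H₀]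
    [NormedAddCommGroup H₁] [InnerProductSpace ℂ H₁] [CompleteSpace H₁]
    (F₀ Q₀ : H₀ →L[ℂ] H₀) (hQ₀pos : Q₀.IsPositive) (hQ₀inj : Function.Injective Q₀)
    (hF₀ : IsSelfAdjoint F₀) (hFQ₀ : F₀ * Q₀ = Q₀ * F₀) (hpyth₀ : F₀ * F₀ + Q₀ * Q₀ = 1)
    (F₁ Q₁ : H₁ →L[ℂ] H₁) (hQ₁pos : Q₁.IsPositive) (hQ₁inj : Function.Injective Q₁)
    (hF₁ : IsSelfAdjoint F₁) (hFQ₁ : F₁ * Q₁ = Q₁ * F₁) (hpyth₁ : F₁ * F₁ + Q₁ * Q₁ = 1)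
    (α : ℝ) (hα0 : 0 ≤ α) (hα1 : α < 1)
    (a : H₀ →L[ℂ] H₁)
    (hadom : ∀ ξ : H₀, ∃ η : H₁, a (Q₀ ξ) = Q₁ η)
    (hrel : ∃ C : ℝ, ∀ (ξ : H₀) (η : H₁), a (Q₀ ξ) = Q₁ η →
      ‖F₁ η - a (F₀ ξ)‖ ≤ C * ‖cfc (fun t : ℝ => t ^ (1 - α)) Q₀ ξ‖) :
    ∀ β : ℝ, 0 ≤ β → β < 1 - α →
      ∃ C : ℝ, ∀ ζ : H₀,
        ‖F₁ (a ζ) - a (F₀ ζ)‖ ≤ C * ‖cfc (fun t : ℝ => t ^ β) Q₀ ζ‖ := by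
  obtain ⟨C, hC⟩ := hrel
  intro β hβ0 hβ1
  obtain ⟨hs₀, t₀, hF₀t, htF₀, hFt₀, hc₀, hb₀⟩ := aux_op F₀ Q₀ hQ₀pos hF₀ hFQ₀ hpyth₀
  obtain ⟨hs₁, t₁, hF₁t, htF₁, hFt₁, hc₁, hb₁⟩ := aux_op F₁ Q₁ hQ₁pos hF₁ hFQ₁ hpyth₁
  have hQ₀sa : IsSelfAdjoint Q₀ := hQ₀pos.isSelfAdjoint
  have hQ₁sa : IsSelfAdjoint Q₁ := hQ₁pos.isSelfAdjoint
  set γ : ℝ := 1 - α - β with hγ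
  have hγ0 : 0 < γ := by linarith
  have hγ1 : γ ≤ 1 := by linarith
  set G := cfc (fun t : ℝ => t ^ β) Q₀ with hG
  have hsplit : cfc (fun t : ℝ => t ^ (1 - α)) Q₀ = cfc (fun t : ℝ => t ^ γ) Q₀ * G := by
    rw [hG, ← cfc_mul _ _ Q₀ (Real.continuous_rpow_const hγ0.le).continuousOn
      (Real.continuous_rpow_const hβ0).continuousOn]
    apply cfc_congr
    intro x hx
    simp only
    rw [← Real.rpow_add_of_nonneg (hs₀ x hx).1 hγ0.le hβ0]
    congr 1
    rw [hγ]; ring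
  have hone₁ : cfc (fun t : ℝ => t ^ (1 : ℝ)) Q₁ = Q₁ := by
    simp only [Real.rpow_one]; exact cfc_id' ℝ Q₁
  have hone₀ : cfc (fun t : ℝ => t ^ (1 : ℝ)) Q₀ = Q₀ := by
    simp only [Real.rpow_one]; exact cfc_id' ℝ Q₀
  have hz₁ : ∀ n : ℕ, ‖t₁ ^ n‖ ≤ 1 := by
    intro n
    have := hb₁ n 0 le_rfl zero_le_one
    simpa [cfc_const_one ℝ Q₁] using this
  have hQ₁b : ∀ n : ℕ, ‖t₁ ^ n * Q₁‖ ≤ ((n : ℝ) + 1) ^ (-1 : ℝ) := by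
    intro n
    have := hb₁ n 1 zero_le_one le_rfl
    rwa [hone₁] at this
  have hQ₀b : ∀ n : ℕ, ‖t₀ ^ n * Q₀‖ ≤ ((n : ℝ) + 1) ^ (-1 : ℝ) := by
    intro n
    have := hb₀ n 1 zero_le_one le_rfl
    rwa [hone₀] at this
  -- the operators X and M
  set X : H₀ →L[ℂ] H₁ := F₁ ∘L a - a ∘L F₀ with hX
  set M : H₀ →L[ℂ] H₁ := F₁ ∘L a ∘L Q₀ - Q₁ ∘L a ∘L F₀ with hM
  have p1 : ∀ v, F₁ v = t₁ v + t₁ (Q₁ v) := fun v => by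
    simpa using DFunLike.congr_fun hF₁t v
  have p0 : ∀ v, F₀ v = t₀ v + t₀ (Q₀ v) := fun v => by
    simpa using DFunLike.congr_fun hF₀t v
  have r1 : ∀ v, t₁ (F₁ v) = v - Q₁ v := fun v => by
    simpa using DFunLike.congr_fun htF₁ v
  have r0 : ∀ v, F₀ (t₀ v) = v - Q₀ v := fun v => by
    simpa using DFunLike.congr_fun hFt₀ v
  have c0 : ∀ v, t₀ (Q₀ v) = Q₀ (t₀ v) := fun v => DFunLike.congr_fun hc₀.eq v
  have hident : ∀ v, X v + t₁ (X (t₀ v)) = M v - t₁ (M (t₀ v)) := by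
    intro v
    simp only [hX, hM, sub_apply, ContinuousLinearMap.comp_apply, map_sub,
      r1, r0]
    simp only [p1, p0, c0, map_add, map_sub]
    abel
  -- bound for the terms
  set c : ℕ → ℝ := fun n => |C| * ((n : ℝ) + 1) ^ (-(1 + γ)) with hc
  have hterm : ∀ (n : ℕ) (v : H₀), ‖(t₁ ^ n) (M ((t₀ ^ n) v))‖ ≤ c n * ‖G v‖ := by
    intro n v
    obtain ⟨η, hη⟩ := hadom ((t₀ ^ n) v)
    have h1 : M ((t₀ ^ n) v) = Q₁ (F₁ η - a (F₀ ((t₀ ^ n) v))) := by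
      have h : F₁ (Q₁ η) = Q₁ (F₁ η) := DFunLike.congr_fun hFQ₁ η
      simp only [hM, sub_apply, ContinuousLinearMap.comp_apply, hη, h, map_sub]
    have h2 := hC _ _ hη
    have h3 : cfc (fun t : ℝ => t ^ (1 - α)) Q₀ ((t₀ ^ n) v) =
        (t₀ ^ n * cfc (fun t : ℝ => t ^ γ) Q₀) (G v) := by
      have hcm : Commute (cfc (fun t : ℝ => t ^ (1 - α)) Q₀) (t₀ ^ n) :=
        (hc₀.symm.cfc_real _).pow_right n
      have := DFunLike.congr_fun hcm.eq v
      rw [hsplit] at this ⊢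
      simpa using this
    have h4 : ‖cfc (fun t : ℝ => t ^ (1 - α)) Q₀ ((t₀ ^ n) v)‖ ≤
        ((n : ℝ) + 1) ^ (-γ) * ‖G v‖ := by
      rw [h3]
      exact (ContinuousLinearMap.le_opNorm _ _).trans
        (mul_le_mul_of_nonneg_right (hb₀ n γ hγ0.le hγ1) (norm_nonneg _))
    have h5 : ‖F₁ η - a (F₀ ((t₀ ^ n) v))‖ ≤ |C| * (((n : ℝ) + 1) ^ (-γ) * ‖G v‖) :=
      h2.trans (mul_le_mul (le_abs_self C) h4 (norm_nonneg _) (abs_nonneg C))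
    rw [h1]
    calc ‖(t₁ ^ n) (Q₁ (F₁ η - a (F₀ ((t₀ ^ n) v))))‖
        = ‖(t₁ ^ n * Q₁) (F₁ η - a (F₀ ((t₀ ^ n) v)))‖ := rfl
      _ ≤ ‖t₁ ^ n * Q₁‖ * ‖F₁ η - a (F₀ ((t₀ ^ n) v))‖ := ContinuousLinearMap.le_opNorm _ _
      _ ≤ ((n : ℝ) + 1) ^ (-1 : ℝ) * (|C| * (((n : ℝ) + 1) ^ (-γ) * ‖G v‖)) :=
        mul_le_mul (hQ₁b n) h5 (norm_nonneg _) (by positivity)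
      _ = c n * ‖G v‖ := by
        have : ((n : ℝ) + 1) ^ (-(1 + γ)) = ((n : ℝ) + 1) ^ (-1 : ℝ) * ((n : ℝ) + 1) ^ (-γ) := by
          rw [← Real.rpow_add (by positivity)]; congr 1; ring
        rw [hc]; simp only; rw [this]; ring
  have hcnn : ∀ n, 0 ≤ c n := fun n => by rw [hc]; positivity
  have hsum : Summable c := by
    apply Summable.mul_left
    have h := (Real.summable_nat_rpow (p := -(1 + γ))).2 (by linarith)
    have := (summable_nat_add_iff 1).2 h
    simpa using this
  set K : ℝ := ∑' n, c n with hK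
  -- finite expansion
  have hfin : ∀ (N : ℕ) (v : H₀),
      ‖X v‖ ≤ (∑ n ∈ Finset.range N, (c n + c (n + 1))) * ‖G v‖ + ‖(t₁ ^ N) (X ((t₀ ^ N) v))‖ := by
    intro N v
    induction N with
    | zero => simp
    | succ N ih =>
      have h1 := hident ((t₀ ^ N) v)
      have h2 : (t₁ ^ N) (X ((t₀ ^ N) v)) = (t₁ ^ N) (M ((t₀ ^ N) v))
          - (t₁ ^ (N + 1)) (M ((t₀ ^ (N + 1)) v)) - (t₁ ^ (N + 1)) (X ((t₀ ^ (N + 1)) v)) := by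
        have e0 : (t₀ ^ (N + 1)) v = t₀ ((t₀ ^ N) v) := by rw [pow_succ']; rfl
        have e1 : ∀ w, (t₁ ^ (N + 1)) w = (t₁ ^ N) (t₁ w) := fun w => by rw [pow_succ]; rfl
        rw [e0, e1, e1, ← map_sub, ← h1, map_add]
        abel
      have h3 : ‖(t₁ ^ N) (X ((t₀ ^ N) v))‖ ≤ c N * ‖G v‖ + c (N + 1) * ‖G v‖
          + ‖(t₁ ^ (N + 1)) (X ((t₀ ^ (N + 1)) v))‖ := by
        rw [h2]
        refine (norm_sub_le _ _).trans (add_le_add ((norm_sub_le _ _).trans ?_) le_rfl)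
        exact add_le_add (hterm N v) (hterm (N + 1) v)
      rw [Finset.sum_range_succ]
      linarith
  have hsumle : ∀ N, ∑ n ∈ Finset.range N, (c n + c (n + 1)) ≤ 2 * K := by
    intro N
    rw [Finset.sum_add_distrib, two_mul]
    refine add_le_add (hsum.sum_le_tsum _ fun i _ => hcnn i) ?_
    have h1 := hsum.sum_le_tsum (Finset.range (N + 1)) fun i _ => hcnn i
    rw [Finset.sum_range_succ'] at h1
    linarith [hcnn 0]
  have hbd : ∀ v, ‖X v‖ ≤ 2 * K * ‖G v‖ := by
    intro v
    refine (aux_dense Q₀ hQ₀sa hQ₀inj).induction_on (p := fun v => ‖X v‖ ≤ 2 * K * ‖G v‖) v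
      (isClosed_le (by fun_prop) (by fun_prop)) ?_
    intro w
    have hlim : Tendsto (fun N : ℕ => 2 * K * ‖G (Q₀ w)‖ +
        ‖X‖ * (((N : ℝ) + 1) ^ (-1 : ℝ) * ‖w‖)) atTop
        (𝓝 (2 * K * ‖G (Q₀ w)‖ + ‖X‖ * (0 * ‖w‖))) := by
      have : Tendsto (fun N : ℕ => ((N : ℝ) + 1) ^ (-1 : ℝ)) atTop (𝓝 0) := by
        simpa [Real.rpow_neg_one] using tendsto_one_div_add_atTop_nhds_zero_nat (𝕜 := ℝ)
      exact tendsto_const_nhds.add ((this.mul_const _).const_mul _)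
    simp only [zero_mul, mul_zero, add_zero] at hlim
    refine ge_of_tendsto' hlim fun N => (hfin N (Q₀ w)).trans ?_
    refine add_le_add (mul_le_mul_of_nonneg_right (hsumle N) (norm_nonneg _)) ?_
    calc ‖(t₁ ^ N) (X ((t₀ ^ N) (Q₀ w)))‖ ≤ 1 * ‖X ((t₀ ^ N) (Q₀ w))‖ :=
          ContinuousLinearMap.le_of_opNorm_le _ (hz₁ N) _
      _ = ‖X ((t₀ ^ N * Q₀) w)‖ := by rw [one_mul]; rfl
      _ ≤ ‖X‖ * ‖(t₀ ^ N * Q₀) w‖ := X.le_opNorm _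
      _ ≤ _ := mul_le_mul_of_nonneg_left
          (ContinuousLinearMap.le_of_opNorm_le _ (hQ₀b N) _) (norm_nonneg _)
  exact ⟨2 * K, fun ζ => hbd ζ⟩
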